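/- Suppose every approximate proximal point used by inexact FedExProx is an ε₂-relative approximation, i.e., ‖x̃_{i,k+1} − prox_{γf_i}(x_k)‖² ≤ ε₂ · ‖x_k − prox_{γf_i}(x_k)‖² for all i and k, where 0 ≤ ε₂ < μ/(4L_max), and take the extrapolation parameter α = 1/(γL_γ). Then for every K ≥ 0, Δ_K ≤ (1 − (1 − 4ε₂L_max/μ) · μ/(4L_γ(1 + γL_max)))^K · (L_γ(1 + γL_max)/μ) · Δ_0. -/

import Mathlib

theorem norm_avg_sq_le {E ι : Type*} [NormedAddCommGroup E] [NormedSpace ℝ E]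
    [Fintype ι] (v : ι → E) :
    ‖(1 / (Fintype.card ι : ℝ)) • ∑ i, v i‖ ^ 2 ≤
      (1 / (Fintype.card ι : ℝ)) * ∑ i, ‖v i‖ ^ 2 := by
  have h1 : ‖∑ i, v i‖ ^ 2 ≤ Fintype.card ι * ∑ i, ‖v i‖ ^ 2 :=
    (pow_le_pow_left₀ (norm_nonneg _) (norm_sum_le _ _) 2).trans sq_sum_le_card_mul_sum_sq
  rw [norm_smul, mul_pow, Real.norm_of_nonneg (by positivity)]
  rcases (Nat.cast_nonneg (α := ℝ) (Fintype.card ι)).eq_or_lt with h | h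
  · simp [← h]
  · calc (1 / (Fintype.card ι : ℝ)) ^ 2 * ‖∑ i, v i‖ ^ 2
        ≤ (1 / (Fintype.card ι : ℝ)) ^ 2 * (Fintype.card ι * ∑ i, ‖v i‖ ^ 2) := by gcongr
      _ = _ := by field_simp

section SmoothConvex

variable {E : Type*} [NormedAddCommGroup E] [InnerProductSpace ℝ E] [CompleteSpace E]

theorem HasGradientAt.hasDerivAt_comp_line {f : E → ℝ} {g x v : E} {t : ℝ}
    (h : HasGradientAt f g (x + t • v)) :
    HasDerivAt (fun s : ℝ => f (x + s • v)) (inner ℝ g v) t := by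
  have hline : HasDerivAt (fun s : ℝ => x + s • v) v t := by
    simpa using ((hasDerivAt_id t).smul_const v).const_add x
  simpa [Function.comp_def] using h.hasFDerivAt.comp_hasDerivAt t hline

/-- The first-order lower bound for differentiable strongly convex functions. -/
theorem StrongConvexOn.le_of_hasGradientAt {f : E → ℝ} {m : ℝ} {g x : E}
    (hf : StrongConvexOn Set.univ m f) (hg : HasGradientAt f g x) (y : E) :
    f x + inner ℝ g (y - x) + m / 2 * ‖y - x‖ ^ 2 ≤ f y := by
  have hder : HasDerivAt (fun s : ℝ => f (x + s • (y - x))) (inner ℝ g (y - x)) 0 :=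
    HasGradientAt.hasDerivAt_comp_line (by simpa using hg)
  have hslope := hder.tendsto_slope_zero_right
  have hright : Filter.Tendsto (fun t : ℝ => f y - f x - (1 - t) * (m / 2 * ‖y - x‖ ^ 2))
      (nhdsWithin 0 (Set.Ioi 0)) (nhds (f y - f x - (1 - 0) * (m / 2 * ‖y - x‖ ^ 2))) :=
    (Continuous.tendsto (by fun_prop) 0).mono_left nhdsWithin_le_nhds
  have hle := le_of_tendsto_of_tendsto hslope hright (by
    filter_upwards [Ioo_mem_nhdsGT (zero_lt_one' ℝ)] with t ht
    have h := hf.2 (Set.mem_univ y) (Set.mem_univ x) ht.1.le (sub_nonneg.2 ht.2.le) (by ring)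
    have hpt : t • y + (1 - t) • x = x + t • (y - x) := by module
    rw [hpt] at h
    simp only [smul_eq_mul, zero_add, zero_smul, add_zero] at h ⊢
    rw [inv_mul_le_iff₀ ht.1]
    linarith)
  linarith

theorem ConvexOn.le_of_hasGradientAt {f : E → ℝ} {g x : E}
    (hf : ConvexOn ℝ Set.univ f) (hg : HasGradientAt f g x) (y : E) :
    f x + inner ℝ g (y - x) ≤ f y := by
  simpa using (strongConvexOn_zero.2 hf).le_of_hasGradientAt hg y

/-- The quadratic upper bound for functions with Lipschitz gradient. -/
theorem le_quadratic_of_lipschitz_gradient {f : E → ℝ} {f' : E → E} {L : ℝ}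
    (hf : ∀ x, HasGradientAt f (f' x) x) (hL : ∀ x y, ‖f' x - f' y‖ ≤ L * ‖x - y‖) (x y : E) :
    f y ≤ f x + inner ℝ (f' x) (y - x) + L / 2 * ‖y - x‖ ^ 2 := by
  set v := y - x with hv
  have hφ (t : ℝ) : HasDerivAt (fun s : ℝ => f (x + s • v)) (inner ℝ (f' (x + t • v)) v) t :=
    HasGradientAt.hasDerivAt_comp_line (hf _)
  have hψ (t : ℝ) : HasDerivAt
      (fun s : ℝ => f x + s * inner ℝ (f' x) v + L / 2 * s ^ 2 * ‖v‖ ^ 2)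
      (inner ℝ (f' x) v + L * t * ‖v‖ ^ 2) t := by
    have h := (((hasDerivAt_id t).mul_const (inner ℝ (f' x) v)).const_add (f x)).add
      ((((hasDerivAt_id t).pow 2).const_mul (L / 2)).mul_const (‖v‖ ^ 2))
    refine h.congr_deriv ?_
    simp only [id_eq, Nat.cast_ofNat]
    ring
  have h := image_le_of_deriv_right_le_deriv_boundary (a := 0) (b := 1)
    (fun t _ => (hφ t).continuousAt.continuousWithinAt) (fun t _ => (hφ t).hasDerivWithinAt)
    (by simp) (fun t _ => (hψ t).continuousAt.continuousWithinAt)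
    (fun t _ => (hψ t).hasDerivWithinAt) (fun t ht => by
      have h1 : inner ℝ (f' (x + t • v) - f' x) v ≤ L * t * ‖v‖ ^ 2 :=
        calc inner ℝ (f' (x + t • v) - f' x) v ≤ ‖f' (x + t • v) - f' x‖ * ‖v‖ :=
              real_inner_le_norm _ _
          _ ≤ L * ‖x + t • v - x‖ * ‖v‖ := by gcongr; exact hL _ _
          _ = L * t * ‖v‖ ^ 2 := by
              rw [add_sub_cancel_left, norm_smul, Real.norm_of_nonneg ht.1]
              ring
      rw [inner_sub_left] at h1
      linarith) (Set.right_mem_Icc.2 zero_le_one)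
  simpa [hv] using h

theorem norm_gradient_sq_le {f : E → ℝ} {f' : E → E} {L c : ℝ} (hLpos : 0 < L)
    (hf : ∀ x, HasGradientAt f (f' x) x) (hL : ∀ x y, ‖f' x - f' y‖ ≤ L * ‖x - y‖)
    (hc : ∀ x, c ≤ f x) (x : E) : ‖f' x‖ ^ 2 ≤ 2 * L * (f x - c) := by
  have h := (hc _).trans (le_quadratic_of_lipschitz_gradient hf hL x (x - L⁻¹ • f' x))
  rw [sub_sub_cancel_left, inner_neg_right, inner_smul_right, norm_neg, norm_smul,
    real_inner_self_eq_norm_sq, Real.norm_of_nonneg (by positivity)] at h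
  have h2 : c * (2 * L) ≤ (f x + -(L⁻¹ * ‖f' x‖ ^ 2) + L / 2 * (L⁻¹ * ‖f' x‖) ^ 2) * (2 * L) := by
    gcongr
  field_simp at h2
  linarith

theorem sub_eq_smul_gradient_of_isMinOn_prox {f : E → ℝ} {g x p : E} {γ : ℝ} (hγ : 0 < γ)
    (hg : HasGradientAt f g p)
    (hp : IsMinOn (fun z => f z + ‖z - x‖ ^ 2 / (2 * γ)) Set.univ p) : x - p = γ • g := by
  have hd : HasGradientAt (fun z => f z + ‖z - x‖ ^ 2 / (2 * γ)) (g + γ⁻¹ • (p - x)) p := by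
    have h := hg.hasFDerivAt.add
      ((((hasFDerivAt_id p).sub_const x).norm_sq).mul_const (2 * γ)⁻¹)
    rw [hasGradientAt_iff_hasFDerivAt]
    refine h.congr_fderiv ?_
    ext v
    simp
    field_simp
  have h0 := (hp.isLocalMin Filter.univ_mem).hasFDerivAt_eq_zero hd.hasFDerivAt
  have h1 : g + γ⁻¹ • (p - x) = 0 :=
    (InnerProductSpace.toDual ℝ E).map_eq_zero_iff.1 h0
  have h2 : γ • (g + γ⁻¹ • (p - x)) = 0 := by rw [h1, smul_zero]
  rw [smul_add, smul_inv_smul₀ hγ.ne'] at h2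
  rw [← sub_eq_zero, ← neg_eq_zero, ← h2]
  abel

/-- One step of gradient descent with step size `1 / L` and gradient error `e`. -/
theorem inexact_gradient_step_le {f : E → ℝ} {f' : E → E} {L : ℝ} (hLpos : 0 < L)
    (hf : ∀ x, HasGradientAt f (f' x) x) (hL : ∀ x y, ‖f' x - f' y‖ ≤ L * ‖x - y‖) (x e : E) :
    f (x - L⁻¹ • (f' x + e)) ≤ f x - (‖f' x‖ ^ 2 - ‖e‖ ^ 2) / (2 * L) := by
  have h := le_quadratic_of_lipschitz_gradient hf hL x (x - L⁻¹ • (f' x + e))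
  rw [sub_sub_cancel_left, inner_neg_right, inner_smul_right, norm_neg, norm_smul,
    inner_add_right, real_inner_self_eq_norm_sq, Real.norm_of_nonneg (by positivity), mul_pow,
    norm_add_sq_real] at h
  refine h.trans (le_of_eq ?_)
  field_simp
  ring

end SmoothConvex

section MoreauEnvelope

variable {E : Type*} [NormedAddCommGroup E] [InnerProductSpace ℝ E] [CompleteSpace E]
  {f : E → ℝ} {f' : E → E} {L γ : ℝ} {xs x p : E}

theorem norm_sub_prox_sq_le (hγ : 0 < γ) (hLpos : 0 < L)
    (hf : ∀ x, HasGradientAt f (f' x) x) (hL : ∀ x y, ‖f' x - f' y‖ ≤ L * ‖x - y‖)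
    (hmin : ∀ y, f xs ≤ f y) (hp : x - p = γ • f' p) :
    (1 + γ * L) * ‖x - p‖ ^ 2 ≤
      2 * L * γ ^ 2 * (f p + ‖p - x‖ ^ 2 / (2 * γ) - f xs) := by
  have hG := norm_gradient_sq_le hLpos hf hL hmin p
  have hn : ‖p - x‖ ^ 2 = γ ^ 2 * ‖f' p‖ ^ 2 := by
    rw [norm_sub_rev, hp, norm_smul, mul_pow, Real.norm_of_nonneg hγ.le]
  rw [norm_sub_rev x p, hn]
  have h2 : γ ^ 2 * ‖f' p‖ ^ 2 / (2 * γ) = γ / 2 * ‖f' p‖ ^ 2 := by field_simp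
  rw [h2]
  nlinarith [mul_le_mul_of_nonneg_left hG (sq_nonneg γ)]

theorem sub_le_mul_moreau_sub (hγ : 0 < γ) (hLpos : 0 < L)
    (hf : ∀ x, HasGradientAt f (f' x) x) (hL : ∀ x y, ‖f' x - f' y‖ ≤ L * ‖x - y‖)
    (hmin : ∀ y, f xs ≤ f y) (hp : x - p = γ • f' p) :
    f x - f xs ≤ (1 + γ * L) * (f p + ‖p - x‖ ^ 2 / (2 * γ) - f xs) := by
  have hG := norm_gradient_sq_le hLpos hf hL hmin p
  have hD := le_quadratic_of_lipschitz_gradient hf hL p x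
  have hn : ‖x - p‖ ^ 2 = γ ^ 2 * ‖f' p‖ ^ 2 := by
    rw [hp, norm_smul, mul_pow, Real.norm_of_nonneg hγ.le]
  rw [hn, hp, inner_smul_right, real_inner_self_eq_norm_sq] at hD
  rw [norm_sub_rev p x, hn]
  have h2 : γ ^ 2 * ‖f' p‖ ^ 2 / (2 * γ) = γ / 2 * ‖f' p‖ ^ 2 := by field_simp
  rw [h2]
  nlinarith [mul_le_mul_of_nonneg_left hG hγ.le]

theorem moreau_sub_le_inner (hγ : 0 < γ)
    (hf : HasGradientAt f (f' p) p) (hconv : ConvexOn ℝ Set.univ f)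
    (hp : x - p = γ • f' p) :
    f p + ‖p - x‖ ^ 2 / (2 * γ) - f xs ≤ (1 / γ) * inner ℝ (x - p) (x - xs) := by
  have hC := hconv.le_of_hasGradientAt hf xs
  have hx : x - xs = γ • f' p - (xs - p) := by rw [← hp]; abel
  rw [norm_sub_rev p x, hx, hp, norm_smul, mul_pow, Real.norm_of_nonneg hγ.le, inner_sub_right,
    inner_smul_left, inner_smul_left, inner_smul_right, real_inner_self_eq_norm_sq]
  simp only [conj_trivial]
  have h2 : γ ^ 2 * ‖f' p‖ ^ 2 / (2 * γ) = γ / 2 * ‖f' p‖ ^ 2 := by field_simp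
  have h3 : 1 / γ * (γ * (γ * ‖f' p‖ ^ 2) - γ * inner ℝ (f' p) (xs - p)) =
      γ * ‖f' p‖ ^ 2 - inner ℝ (f' p) (xs - p) := by field_simp
  rw [h2, h3]
  nlinarith [mul_nonneg hγ.le (sq_nonneg ‖f' p‖)]

end MoreauEnvelope


theorem fedexprox_rel_comp_Delta
    {d n : ℕ} (hn : 1 ≤ n)
    (f : Fin n → EuclideanSpace ℝ (Fin d) → ℝ)
    (f' : Fin n → EuclideanSpace ℝ (Fin d) → EuclideanSpace ℝ (Fin d))
    (L : Fin n → ℝ) (hLpos : ∀ i, 0 < L i)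
    (hdiff : ∀ i x, HasGradientAt (f i) (f' i x) x)
    (hconv : ∀ i, ConvexOn ℝ Set.univ (f i))
    (hsmooth : ∀ i x y, ‖f' i x - f' i y‖ ≤ L i * ‖x - y‖)
    (Lmax : ℝ) (hLmax : IsGreatest (Set.range L) Lmax)
    (xstar : EuclideanSpace ℝ (Fin d)) (hinterp : ∀ i, f' i xstar = 0)
    (μ : ℝ) (hμ : 0 < μ)
    (hsc : StrongConvexOn Set.univ μ (fun x => (1 / (n : ℝ)) * ∑ i, f i x))
    (γ : ℝ) (hγ : 0 < γ)
    (prox : Fin n → EuclideanSpace ℝ (Fin d) → EuclideanSpace ℝ (Fin d))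
    (hprox : ∀ i x, IsMinOn (fun z => f i z + ‖z - x‖ ^ 2 / (2 * γ)) Set.univ (prox i x))
    (hproxu : ∀ i x q, IsMinOn (fun z => f i z + ‖z - x‖ ^ 2 / (2 * γ)) Set.univ q → q = prox i x)
    (M : EuclideanSpace ℝ (Fin d) → ℝ)
    (hM : ∀ x, M x = (1 / (n : ℝ)) * ∑ i, (f i (prox i x) + ‖prox i x - x‖ ^ 2 / (2 * γ)))
    (M' : EuclideanSpace ℝ (Fin d) → EuclideanSpace ℝ (Fin d))
    (hM' : ∀ x, M' x = (1 / ((n : ℝ) * γ)) • ∑ i, (x - prox i x))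
    (hMdiff : ∀ x, HasGradientAt M (M' x) x)
    (Minf : ℝ) (hMinf : Minf = M xstar) (hMinfLB : ∀ x, Minf ≤ M x)
    (Lγ : ℝ) (hLγ : 0 < Lγ)
    (hMLip : ∀ x y, ‖M' x - M' y‖ ≤ Lγ * ‖x - y‖)
    (α : ℝ)
    (xseq : ℕ → EuclideanSpace ℝ (Fin d))
    (xtil : Fin n → ℕ → EuclideanSpace ℝ (Fin d))
    (hrec : ∀ k : ℕ, xseq (k + 1) = xseq k + α • ((1 / (n : ℝ)) • (∑ i, xtil i k) - xseq k))
    (ε₂ : ℝ) (hε₂ : 0 ≤ ε₂)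
    (happrox : ∀ (i : Fin n) (k : ℕ),
      ‖xtil i k - prox i (xseq k)‖ ^ 2 ≤ ε₂ * ‖xseq k - prox i (xseq k)‖ ^ 2)
    (hε₂lt : ε₂ < μ / (4 * Lmax))
    (hα : α = 1 / (γ * Lγ))
    : ∀ K : ℕ,
      ‖xseq K - xstar‖ ^ 2 ≤
        (1 - (1 - 4 * ε₂ * Lmax / μ) * μ / (4 * Lγ * (1 + γ * Lmax))) ^ K *
          (Lγ * (1 + γ * Lmax) / μ) * ‖xseq 0 - xstar‖ ^ 2 := by
  have hn0 : (0 : ℝ) < n := by exact_mod_cast hn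
  obtain ⟨i₀, hi₀⟩ := hLmax.1
  have hLm : 0 < Lmax := hi₀ ▸ hLpos i₀
  have hsmooth' : ∀ i x y, ‖f' i x - f' i y‖ ≤ Lmax * ‖x - y‖ := fun i x y =>
    (hsmooth i x y).trans (by gcongr; exact hLmax.2 ⟨i, rfl⟩)
  have hmin : ∀ i y, f i xstar ≤ f i y := fun i y => by
    simpa [hinterp i] using (hconv i).le_of_hasGradientAt (hdiff i xstar) y
  have hopt : ∀ i x, x - prox i x = γ • f' i (prox i x) := fun i x =>
    sub_eq_smul_gradient_of_isMinOn_prox hγ (hdiff i _) (hprox i x)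
  have hproxs : ∀ i, prox i xstar = xstar := fun i => by
    refine (hproxu i xstar xstar fun z _ => ?_).symm
    have : 0 ≤ ‖z - xstar‖ ^ 2 / (2 * γ) := by positivity
    simpa using (hmin i z).trans (le_add_of_nonneg_right this)
  have hMs : M' xstar = 0 := by simp [hM', hproxs]
  have hgap : ∀ x, M x - Minf =
      (1 / (n : ℝ)) * ∑ i, (f i (prox i x) + ‖prox i x - x‖ ^ 2 / (2 * γ) - f i xstar) := by
    intro x
    rw [hMinf, hM x, hM xstar, Finset.sum_sub_distrib, mul_sub]
    simp [hproxs]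
  set C := 1 + γ * Lmax with hC
  have hC0 : 0 < C := by positivity
  have hgrowth : ∀ x, μ / 2 * ‖x - xstar‖ ^ 2 ≤ C * (M x - Minf) := by
    intro x
    have hgrad : HasGradientAt (fun x => (1 / (n : ℝ)) * ∑ i, f i x) 0 xstar := by
      rw [hasGradientAt_iff_hasFDerivAt]
      refine ((HasFDerivAt.fun_sum fun i (_ : i ∈ Finset.univ) =>
        (hdiff i xstar).hasFDerivAt).const_mul (1 / (n : ℝ))).congr_fderiv ?_
      simp [hinterp]
    have h := hsc.le_of_hasGradientAt hgrad x
    rw [inner_zero_left] at h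
    have h2 : (1 / (n : ℝ)) * ∑ i, (f i x - f i xstar) ≤ C * (M x - Minf) := by
      rw [hgap, mul_left_comm, Finset.mul_sum (a := C)]
      gcongr with i
      exact sub_le_mul_moreau_sub hγ hLm (hdiff i) (hsmooth' i) (hmin i) (hopt i x)
    rw [Finset.sum_sub_distrib, mul_sub] at h2
    linarith
  have hupper : ∀ x, M x - Minf ≤ Lγ / 2 * ‖x - xstar‖ ^ 2 := by
    intro x
    have h := le_quadratic_of_lipschitz_gradient hMdiff hMLip xstar x
    rw [hMs, inner_zero_left, ← hMinf] at h
    linarith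
  have hPL : ∀ x, μ * (M x - Minf) ≤ 2 * C * ‖M' x‖ ^ 2 := by
    intro x
    have hin : M x - Minf ≤ inner ℝ (M' x) (x - xstar) := by
      rw [hgap, hM', inner_smul_left, sum_inner, conj_trivial, one_div_mul_eq_div, ← div_div,
        div_mul_eq_mul_div, one_div_mul_eq_div, div_right_comm]
      gcongr
      rw [Finset.sum_div]
      gcongr with i
      rw [← one_div_mul_eq_div γ]
      exact moreau_sub_le_inner hγ (hdiff i _) (hconv i) (hopt i x)
    have hE : 0 ≤ M x - Minf := sub_nonneg.2 (hMinfLB x)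
    have hcs : (M x - Minf) ^ 2 ≤ ‖M' x‖ ^ 2 * ‖x - xstar‖ ^ 2 := by
      rw [← mul_pow]
      exact pow_le_pow_left₀ hE (hin.trans (real_inner_le_norm _ _)) 2
    rcases hE.eq_or_lt with h0 | h0
    · rw [← h0, mul_zero]
      positivity
    · refine le_of_mul_le_mul_right ?_ h0
      nlinarith [mul_le_mul_of_nonneg_left (hgrowth x) (sq_nonneg ‖M' x‖)]
  set e : ℕ → EuclideanSpace ℝ (Fin d) := fun k =>
    γ⁻¹ • ((1 / (n : ℝ)) • ∑ i, (prox i (xseq k) - xtil i k)) with he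
  have herr : ∀ k, C * ‖e k‖ ^ 2 ≤ 2 * ε₂ * Lmax * (M (xseq k) - Minf) := by
    intro k
    have h1 := norm_avg_sq_le fun i => prox i (xseq k) - xtil i k
    rw [Fintype.card_fin] at h1
    have h2 : C * ((1 / (n : ℝ)) * ∑ i, ‖prox i (xseq k) - xtil i k‖ ^ 2) ≤
        ε₂ * (2 * Lmax * γ ^ 2) * (M (xseq k) - Minf) := by
      rw [hgap, mul_left_comm, mul_left_comm (ε₂ * _), Finset.mul_sum,
        Finset.mul_sum (a := ε₂ * _)]
      refine mul_le_mul_of_nonneg_left (Finset.sum_le_sum fun i _ => ?_) (by positivity)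
      have h3 := norm_sub_prox_sq_le hγ hLm (hdiff i) (hsmooth' i) (hmin i) (hopt i (xseq k))
      have h4 := happrox i k
      rw [norm_sub_rev] at h4
      nlinarith [mul_le_mul_of_nonneg_left h4 hC0.le, mul_le_mul_of_nonneg_left h3 hε₂]
    rw [he]
    simp only
    rw [norm_smul, mul_pow, Real.norm_of_nonneg (by positivity)]
    have h5 := (mul_le_mul_of_nonneg_left h1 hC0.le).trans h2
    have h6 := mul_le_mul_of_nonneg_left h5 (sq_nonneg γ⁻¹)
    refine le_trans (le_of_eq ?_) (h6.trans (le_of_eq ?_))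
    · ring
    · field_simp
  have hstep : ∀ k, xseq (k + 1) = xseq k - Lγ⁻¹ • (M' (xseq k) + e k) := by
    intro k
    have h : M' (xseq k) + e k = γ⁻¹ • (xseq k - (1 / (n : ℝ)) • ∑ i, xtil i k) := by
      have hx : (1 / (n : ℝ)) • ((n : ℝ) • xseq k) = xseq k := by
        rw [smul_smul, one_div_mul_cancel hn0.ne', one_smul]
      have hc : 1 / ((n : ℝ) * γ) = γ⁻¹ * (1 / (n : ℝ)) := by field_simp
      rw [he, hM', hc, mul_smul, ← smul_add, ← smul_add, ← Finset.sum_add_distrib]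
      simp only [sub_add_sub_cancel, Finset.sum_sub_distrib, Finset.sum_const, Finset.card_univ,
        Fintype.card_fin, smul_sub]
      rw [← Nat.cast_smul_eq_nsmul ℝ, hx]
    rw [h, hrec, hα, smul_smul, one_div, mul_inv, mul_comm Lγ⁻¹, ← neg_sub (xseq k), smul_neg]
    exact (sub_eq_add_neg _ _).symm
  set ρ := 1 - (1 - 4 * ε₂ * Lmax / μ) * μ / (4 * Lγ * C) with hρ
  have hcontr : ∀ k, M (xseq (k + 1)) - Minf ≤ ρ * (M (xseq k) - Minf) := by
    intro k
    have h := inexact_gradient_step_le hLγ hMdiff hMLip (xseq k) (e k)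
    rw [← hstep] at h
    have h1 := hPL (xseq k)
    have h2 := herr k
    have h3 : (1 - ρ) * (M (xseq k) - Minf) ≤ (‖M' (xseq k)‖ ^ 2 - ‖e k‖ ^ 2) / (2 * Lγ) := by
      have : 1 - ρ = (μ - 4 * ε₂ * Lmax) / (4 * Lγ * C) := by
        rw [hρ]
        field_simp
        ring
      rw [this, div_mul_eq_mul_div, div_le_div_iff₀ (by positivity) (by positivity)]
      have h4 : (μ - 4 * ε₂ * Lmax) * (M (xseq k) - Minf) ≤
          2 * C * (‖M' (xseq k)‖ ^ 2 - ‖e k‖ ^ 2) := by linarith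
      have h5 := mul_le_mul_of_nonneg_right h4 (by positivity : 0 ≤ 2 * Lγ)
      linarith
    linarith
  rcases subsingleton_or_nontrivial (EuclideanSpace ℝ (Fin d)) with hd | hd
  · intro K
    simp [Subsingleton.elim (xseq K) xstar, Subsingleton.elim (xseq 0) xstar]
  have hμL : μ ≤ Lγ * C := by
    obtain ⟨y, hy⟩ := exists_ne xstar
    have hpos : 0 < ‖y - xstar‖ ^ 2 := by
      have := norm_pos_iff.2 (sub_ne_zero.2 hy)
      positivity
    refine le_of_mul_le_mul_right ?_ hpos
    linarith [hgrowth y, mul_le_mul_of_nonneg_left (hupper y) hC0.le]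
  have hρ0 : 0 ≤ ρ := by
    have h1 : (1 - 4 * ε₂ * Lmax / μ) * μ ≤ 4 * Lγ * C := by
      have : 0 ≤ 4 * ε₂ * Lmax := by positivity
      have h2 : (1 - 4 * ε₂ * Lmax / μ) * μ = μ - 4 * ε₂ * Lmax := by field_simp
      have h3 : 0 < Lγ * C := by positivity
      linarith
    exact sub_nonneg.2 (div_le_one_of_le₀ h1 (by positivity))
  have hgeom : ∀ K, M (xseq K) - Minf ≤ ρ ^ K * (M (xseq 0) - Minf) := by
    intro K
    induction K with
    | zero => simp
    | succ K ih =>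
      rw [pow_succ', mul_assoc]
      exact (hcontr K).trans (mul_le_mul_of_nonneg_left ih hρ0)
  intro K
  have h1 : M (xseq K) - Minf ≤ ρ ^ K * (Lγ / 2 * ‖xseq 0 - xstar‖ ^ 2) :=
    (hgeom K).trans (by gcongr; exact hupper _)
  have h2 := (hgrowth (xseq K)).trans (mul_le_mul_of_nonneg_left h1 hC0.le)
  calc ‖xseq K - xstar‖ ^ 2 = 2 / μ * (μ / 2 * ‖xseq K - xstar‖ ^ 2) := by field_simp
    _ ≤ 2 / μ * (C * (ρ ^ K * (Lγ / 2 * ‖xseq 0 - xstar‖ ^ 2))) := by gcongr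
    _ = ρ ^ K * (Lγ * C / μ) * ‖xseq 0 - xstar‖ ^ 2 := by field_simp
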